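/- Let N ≥ 1 and 0 ≤ κ ≤ κ' ≤ N−1, and let V^{N,κ} and V^{N,κ'} be the truncated solutions with top rows (N,κ) and (N,κ') respectively. Then V^{N,κ} n 0 ≥ V^{N,κ'} n 0 for every 1 ≤ n ≤ N. -/

import Mathlib

/-- Number of descents of a permutation of `Fin n`: indices `j` with `j+1 < n`
and `π j > π (j+1)`. -/
noncomputable def descents {n : ℕ} (π : Equiv.Perm (Fin n)) : ℕ :=
  Nat.card {j : Fin n // ∃ h : (j : ℕ) + 1 < n, π ⟨(j : ℕ) + 1, h⟩ < π j}

/-- The Eulerian number `⟨n,k⟩`: the number of permutations of `Fin n` with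
exactly `k` descents. -/
noncomputable def eulerian (n k : ℕ) : ℕ :=
  Nat.card {π : Equiv.Perm (Fin n) // descents π = k}

/-- `IsTrunc N κ V` : `V` is the truncated solution with top row `(N, κ)`:
the top row `V N ·` is the delta at `κ` normalized by the Eulerian number
`⟨N,κ⟩`, and the dual recursion holds for `1 ≤ n ≤ N-1`, `0 ≤ k ≤ n-1`. -/
def IsTrunc (N κ : ℕ) (V : ℕ → ℕ → ℝ) : Prop :=
  (∀ k : ℕ, k ≤ N - 1 → V N k = if k = κ then 1 / (eulerian N κ : ℝ) else 0) ∧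
  (∀ n k : ℕ, 1 ≤ n → n ≤ N - 1 → k ≤ n - 1 →
    V n k = ((k : ℝ) + 1) * V (n + 1) k + ((n : ℝ) - (k : ℝ)) * V (n + 1) (k + 1))

/-- Word of a permutation, as a function on the natural numbers. -/
def wordOf {n : ℕ} (π : Equiv.Perm (Fin n)) (i : ℕ) : ℕ :=
  if h : i < n then (π ⟨i, h⟩ : ℕ) else 0

/-- Descent indicator sum of a word on the first `m` places. -/
def desSum (w : ℕ → ℕ) (m : ℕ) : ℕ := ∑ i ∈ Finset.range m, if w (i + 1) < w i then 1 else 0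

lemma descents_eq {m : ℕ} (π : Equiv.Perm (Fin (m + 1))) :
    descents π = desSum (wordOf π) m := by
  classical
  unfold descents desSum
  rw [← Finset.card_filter, Nat.card_eq_fintype_card, Fintype.card_subtype]
  refine Finset.card_bij (fun j _ => (j : ℕ)) ?_ ?_ ?_
  · intro j hj
    simp only [Finset.mem_filter, Finset.mem_univ, true_and, Finset.mem_range] at hj ⊢
    obtain ⟨h, hj⟩ := hj
    refine ⟨by omega, ?_⟩
    rw [wordOf, wordOf, dif_pos h, dif_pos j.2]
    exact hj
  · intro a _ b _ h
    exact Fin.ext h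
  · intro b hb
    simp only [Finset.mem_filter, Finset.mem_range] at hb
    obtain ⟨h, hb⟩ := hb
    have h1 : b < m + 1 := by omega
    refine ⟨⟨b, h1⟩, ?_, rfl⟩
    simp only [Finset.mem_filter, Finset.mem_univ, true_and]
    refine ⟨by simpa using h, ?_⟩
    simpa [wordOf, h, h1] using hb

/-- Insert the largest letter at position `p`. -/
def insPerm {n : ℕ} (p : Fin (n + 1)) (σ : Equiv.Perm (Fin n)) : Equiv.Perm (Fin (n + 1)) :=
  ((finSuccEquiv' p).trans (Equiv.optionCongr σ)).trans (finSuccEquiv' (Fin.last n)).symm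

lemma insPerm_self {n : ℕ} (p : Fin (n + 1)) (σ : Equiv.Perm (Fin n)) :
    insPerm p σ p = Fin.last n := by
  simp [insPerm]

lemma insPerm_succAbove {n : ℕ} (p : Fin (n + 1)) (σ : Equiv.Perm (Fin n)) (i : Fin n) :
    insPerm p σ (p.succAbove i) = (σ i).castSucc := by
  simp [insPerm]

lemma insPerm_bij (n : ℕ) :
    Function.Bijective (fun x : Fin (n + 1) × Equiv.Perm (Fin n) => insPerm x.1 x.2) := by
  rw [Fintype.bijective_iff_injective_and_card]
  constructor
  · rintro ⟨p, σ⟩ ⟨q, τ⟩ h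
    simp only at h
    have hpq : p = q := by
      have h1 := insPerm_self p σ
      rw [h, ← insPerm_self q τ] at h1
      exact (insPerm q τ).injective h1
    subst hpq
    have : σ = τ := by
      ext i
      have h1 := insPerm_succAbove p σ i
      rw [h, insPerm_succAbove] at h1
      exact congrArg Fin.val (Fin.castSucc_injective _ h1).symm
    rw [this]
  · simp [Fintype.card_perm, Nat.factorial_succ]

lemma word_ins_lt {n : ℕ} (p : Fin (n + 1)) (σ : Equiv.Perm (Fin n)) (i : ℕ) (hi : i < p) :
    wordOf (insPerm p σ) i = wordOf σ i := by
  have hn : i < n := by omega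
  have h := insPerm_succAbove p σ ⟨i, hn⟩
  rw [Fin.succAbove_of_castSucc_lt _ _ (by simpa [Fin.lt_def] using hi)] at h
  have h2 : i < n + 1 := by omega
  simp only [wordOf, hn, h2, dif_pos]
  exact congrArg Fin.val h

lemma word_ins_eq {n : ℕ} (p : Fin (n + 1)) (σ : Equiv.Perm (Fin n)) :
    wordOf (insPerm p σ) p = n := by
  rw [wordOf, dif_pos p.2]
  exact congrArg Fin.val (insPerm_self p σ)

lemma word_ins_gt {n : ℕ} (p : Fin (n + 1)) (σ : Equiv.Perm (Fin n)) (i : ℕ) (hi : p ≤ i)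
    (hn : i < n) :
    wordOf (insPerm p σ) (i + 1) = wordOf σ i := by
  have h := insPerm_succAbove p σ ⟨i, hn⟩
  rw [Fin.succAbove_of_le_castSucc _ _ (by simpa [Fin.le_def] using hi)] at h
  have h2 : i + 1 < n + 1 := by omega
  simp only [wordOf, hn, h2, dif_pos]
  exact congrArg Fin.val h

lemma word_lt {n : ℕ} (σ : Equiv.Perm (Fin (n + 1))) (i : ℕ) : wordOf σ i < n + 1 := by
  unfold wordOf
  split_ifs <;> omega

/-- Effect of an insertion on the descent number. -/
lemma desSum_ins {m : ℕ} (p : Fin (m + 2)) (σ : Equiv.Perm (Fin (m + 1))) :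
    desSum (wordOf (insPerm p σ)) (m + 1) =
      if (p : ℕ) = m + 1 ∨ (0 < (p : ℕ) ∧ wordOf σ p < wordOf σ (p - 1)) then
        desSum (wordOf σ) m else desSum (wordOf σ) m + 1 := by
  have hlt := word_ins_lt p σ
  have heq := word_ins_eq p σ
  have hgt := word_ins_gt p σ
  have hw := word_lt σ
  have hw0 : ¬ wordOf σ (m + 1) < wordOf σ m ∨ wordOf σ (m + 1) < wordOf σ m := by tauto
  generalize wordOf (insPerm p σ) = w' at *
  generalize wordOf σ = w at *
  obtain ⟨p, hp⟩ := p
  simp only at *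
  have h0 : ∀ r, r + 1 ≤ p →
      (∑ i ∈ Finset.range r, if w' (i + 1) < w' i then 1 else 0) =
      (∑ i ∈ Finset.range r, if w (i + 1) < w i then 1 else 0) := by
    intro r hr
    apply Finset.sum_congr rfl
    intro i hi
    rw [Finset.mem_range] at hi
    rw [hlt _ (by omega), hlt _ (by omega)]
  unfold desSum
  by_cases hpm : p = m + 1
  · subst hpm
    simp only [true_or, if_true]
    rw [Finset.sum_range_succ, h0 m (by omega), heq, hlt m (by omega)]
    have := hw m
    simp; omega
  · obtain ⟨r, rfl⟩ : ∃ r, m = p + r := ⟨m - p, by omega⟩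
    have e1 : p + r + 1 = (p + 1) + r := by omega
    have h1 : (∑ i ∈ Finset.range r, if w' (p + 1 + i + 1) < w' (p + 1 + i) then 1 else 0) =
        ∑ i ∈ Finset.range r, if w (p + i + 1) < w (p + i) then 1 else 0 := by
      apply Finset.sum_congr rfl
      intro i hi
      rw [Finset.mem_range] at hi
      rw [show p + 1 + i = p + i + 1 by omega, hgt (p + i + 1) (by omega) (by omega),
        hgt (p + i) (by omega) (by omega)]
    rw [e1, Finset.sum_range_add, Finset.sum_range_succ, Finset.sum_range_add, h1, heq,
      hgt p le_rfl (by omega), if_pos (hw p)]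
    simp only [← e1, hpm, false_or]
    rcases p with _ | q
    · simp; omega
    · rw [Finset.sum_range_succ, Finset.sum_range_succ, h0 q le_rfl, heq, hlt q (by omega)]
      have := hw q
      rw [if_neg (by omega)]
      simp only [Nat.succ_pos, true_and, Nat.add_sub_cancel]
      split_ifs <;> omega

lemma count_same {m : ℕ} (w : ℕ → ℕ) :
    (∑ p : Fin (m + 2), if ((p : ℕ) = m + 1 ∨ (0 < (p : ℕ) ∧ w p < w (p - 1)))
      then 1 else 0) = desSum w m + 1 := by
  rw [Fin.sum_univ_eq_sum_range
    (fun p => if (p = m + 1 ∨ (0 < p ∧ w p < w (p - 1))) then 1 else 0)]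
  rw [Finset.sum_range_succ, Finset.sum_range_succ']
  simp only [true_or, if_true]
  simp only [Nat.succ_pos, true_and, Nat.add_sub_cancel]
  unfold desSum
  congr 1
  simp only [Nat.add_right_cancel_iff]
  rw [if_neg (by simp), add_zero]
  apply Finset.sum_congr rfl
  intro i hi
  rw [Finset.mem_range] at hi
  have : i ≠ m := by omega
  simp [this]

lemma eulerian_eq (m k : ℕ) :
    eulerian (m + 1) k = ∑ σ : Equiv.Perm (Fin (m + 1)),
      if desSum (wordOf σ) m = k then 1 else 0 := by
  unfold eulerian
  simp only [descents_eq]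
  rw [Nat.card_eq_fintype_card, Fintype.card_subtype, Finset.card_filter]

lemma desSum_le (w : ℕ → ℕ) (m : ℕ) : desSum w m ≤ m := by
  unfold desSum
  rw [← Finset.card_filter]
  exact (Finset.card_filter_le _ _).trans (by simp)

lemma eulerian_zero (m k : ℕ) (hk : m < k) : eulerian (m + 1) k = 0 := by
  rw [eulerian_eq]
  apply Finset.sum_eq_zero
  intro σ _
  have := desSum_le (wordOf σ) m
  rw [if_neg (by omega)]

/-- Sum over insertions. -/
lemma sum_ins (m k : ℕ) (σ : Equiv.Perm (Fin (m + 1))) :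
    (∑ p : Fin (m + 2), if desSum (wordOf (insPerm p σ)) (m + 1) = k then (1 : ℝ) else 0) =
      (if desSum (wordOf σ) m = k then (k : ℝ) + 1 else 0) +
      (if desSum (wordOf σ) m + 1 = k then (m : ℝ) + 2 - k else 0) := by
  have hc := count_same (m := m) (wordOf σ)
  have hc' : (∑ p : Fin (m + 2), if ((p : ℕ) = m + 1 ∨ (0 < (p : ℕ) ∧ wordOf σ p < wordOf σ (p - 1))) then (1 : ℝ) else 0) = desSum (wordOf σ) m + 1 := by
    exact_mod_cast hc
  simp only [desSum_ins]
  by_cases h1 : desSum (wordOf σ) m = k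
  · subst h1
    simp only [if_true]
    rw [if_neg (by omega), add_zero, ← hc']
    apply Finset.sum_congr rfl
    intro p _
    split_ifs <;> first | rfl | omega
  · by_cases h2 : desSum (wordOf σ) m + 1 = k
    · rw [if_neg h1, if_pos h2, zero_add]
      have : ∀ p : Fin (m + 2), (if (if (p : ℕ) = m + 1 ∨ (0 < (p : ℕ) ∧ wordOf σ p < wordOf σ (p - 1)) then desSum (wordOf σ) m
          else desSum (wordOf σ) m + 1) = k then (1 : ℝ) else 0) =
          1 - (if ((p : ℕ) = m + 1 ∨ (0 < (p : ℕ) ∧ wordOf σ p < wordOf σ (p - 1))) then (1 : ℝ) else 0) := by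
        intro p
        split_ifs <;> first | omega | norm_num
      simp only [this]
      rw [Finset.sum_sub_distrib, hc', ← h2]
      simp <;> ring
    · rw [if_neg h1, if_neg h2, zero_add]
      apply Finset.sum_eq_zero
      intro p _
      split_ifs <;> first | rfl | omega

lemma eulerian_rec (m k : ℕ) :
    (eulerian (m + 2) k : ℝ) = ((k : ℝ) + 1) * eulerian (m + 1) k +
      ((m : ℝ) + 2 - k) * ∑ σ : Equiv.Perm (Fin (m + 1)),
        (if desSum (wordOf σ) m + 1 = k then (1 : ℝ) else 0) := by
  rw [eulerian_eq (m + 1), eulerian_eq m]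
  push_cast
  rw [← (insPerm_bij (m + 1)).sum_comp
    (fun π => if desSum (wordOf π) (m + 1) = k then (1 : ℝ) else 0)]
  rw [Fintype.sum_prod_type_right]
  simp only [sum_ins]
  rw [Finset.sum_add_distrib, Finset.mul_sum, Finset.mul_sum]
  simp

lemma eulerian_rec_zero (m : ℕ) :
    (eulerian (m + 2) 0 : ℝ) = eulerian (m + 1) 0 := by
  rw [eulerian_rec]; simp

lemma eulerian_rec_succ (m k : ℕ) :
    (eulerian (m + 2) (k + 1) : ℝ) = ((k : ℝ) + 2) * eulerian (m + 1) (k + 1) +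
      ((m : ℝ) + 1 - k) * eulerian (m + 1) k := by
  rw [eulerian_rec, eulerian_eq m k]
  simp only [Nat.add_right_cancel_iff]
  push_cast
  ring

lemma eulerian_pos (m k : ℕ) (hk : k ≤ m) : (0 : ℝ) < eulerian (m + 1) k := by
  induction m generalizing k with
  | zero =>
    obtain rfl : k = 0 := by omega
    rw [eulerian_eq]
    simp [desSum]
  | succ m ih =>
    rcases k with _ | k
    · rw [eulerian_rec_zero]; exact ih 0 (by omega)
    · rw [eulerian_rec_succ]
      have h1 := ih k (by omega)
      have h2 : (k : ℝ) ≤ m := by exact_mod_cast (by omega : k ≤ m)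
      have h3 : (0 : ℝ) < ((m : ℝ) + 1 - k) * eulerian (m + 1) k :=
        mul_pos (by linarith) h1
      positivity

/-- Forward path counts from `(n,0)`. -/
def fwd (n : ℕ) : ℕ → ℕ → ℝ
  | 0, k => if k = 0 then 1 else 0
  | d + 1, 0 => fwd n d 0
  | d + 1, k + 1 => ((k : ℝ) + 2) * fwd n d (k + 1) + ((n : ℝ) + d - k) * fwd n d k

lemma fwd_zero (n : ℕ) (hn : 1 ≤ n) (d k : ℕ) (hk : n + d ≤ k) : fwd n d k = 0 := by
  induction d generalizing k with
  | zero => simp only [fwd]; rw [if_neg (by omega)]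
  | succ d ih =>
    rcases k with _ | k
    · omega
    · simp only [fwd]
      rw [ih (k + 1) (by omega), ih k (by omega)]; simp

lemma fwd_nonneg (n : ℕ) (hn : 1 ≤ n) (d k : ℕ) : 0 ≤ fwd n d k := by
  induction d generalizing k with
  | zero => simp only [fwd]; split_ifs <;> norm_num
  | succ d ih =>
    rcases k with _ | k
    · exact ih 0
    · simp only [fwd]
      rcases le_or_gt (n + d) k with h | h
      · rw [fwd_zero n hn d k h, mul_zero, add_zero]
        exact mul_nonneg (by positivity) (ih _)
      · have h2 : (k : ℝ) ≤ n + d := by exact_mod_cast h.le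
        exact add_nonneg (mul_nonneg (by positivity) (ih _))
          (mul_nonneg (by linarith) (ih _))

/-- The likelihood ratio order is preserved. -/
lemma lr (m d i j : ℕ) (hij : i ≤ j) :
    fwd (m + 1) d j * eulerian (m + 1 + d) i ≤ fwd (m + 1) d i * eulerian (m + 1 + d) j := by
  induction d generalizing i j with
  | zero =>
    simp only [fwd]
    rcases Nat.eq_zero_or_pos j with h | h
    · obtain rfl : i = j := by omega
      exact le_rfl
    · rw [if_neg (by omega), zero_mul]
      split_ifs <;> positivity
  | succ d ih =>
    rw [show m + 1 + (d + 1) = (m + d) + 2 by omega]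
    rw [show m + 1 + d = m + d + 1 by omega] at ih
    rcases eq_or_lt_of_le hij with rfl | hij
    · exact le_rfl
    rcases j with _ | j
    · omega
    have hf := fwd_zero (m + 1) (by omega) d
    have hfn := fwd_nonneg (m + 1) (by omega) d
    rcases lt_or_ge (m + d) j with hj | hj
    · simp only [fwd]
      rw [hf j (by omega), hf (j + 1) (by omega)]
      simp only [mul_zero, add_zero, zero_mul]
      exact mul_nonneg (fwd_nonneg (m + 1) (by omega) (d + 1) i) (by positivity)
    have hb : (0 : ℝ) ≤ (m : ℝ) + d + 1 - j := by
      have : (j : ℝ) ≤ m + d := by exact_mod_cast hj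
      linarith
    have ha : (0 : ℝ) ≤ (j : ℝ) + 2 := by positivity
    rcases i with _ | i
    · rw [eulerian_rec_zero, eulerian_rec_succ]
      simp only [fwd]
      push_cast
      have t1 := mul_le_mul_of_nonneg_left (ih 0 (j + 1) (by omega)) ha
      have t2 := mul_le_mul_of_nonneg_left (ih 0 j (by omega)) hb
      linear_combination t1 + t2
    · rw [eulerian_rec_succ, eulerian_rec_succ]
      simp only [fwd]
      push_cast
      have hb' : (0 : ℝ) ≤ (m : ℝ) + d + 1 - i := by
        have : (i : ℝ) ≤ m + d := by exact_mod_cast (by omega : i ≤ m + d)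
        linarith
      have ha' : (0 : ℝ) ≤ (i : ℝ) + 2 := by positivity
      have t1 := mul_le_mul_of_nonneg_left (ih (i + 1) (j + 1) (by omega)) (mul_nonneg ha ha')
      have t2 := mul_le_mul_of_nonneg_left (ih i j (by omega)) (mul_nonneg hb hb')
      have t3 := mul_le_mul_of_nonneg_left (ih i (j + 1) (by omega)) (mul_nonneg ha hb')
      have t4 := mul_le_mul_of_nonneg_left (ih (i + 1) j (by omega)) (mul_nonneg hb ha')
      linear_combination t1 + t2 + t3 + t4

lemma duality (N κ : ℕ) (V : ℕ → ℕ → ℝ) (hV : IsTrunc N κ V) (n : ℕ) (hn : 1 ≤ n)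
    (d : ℕ) (hd : n + d ≤ N) :
    V n 0 = ∑ k ∈ Finset.range (n + d), fwd n d k * V (n + d) k := by
  induction d with
  | zero =>
    rw [Finset.sum_eq_single 0]
    · simp [fwd]
    · intro b _ hb
      simp [fwd, hb]
    · intro h
      simp at h
      omega
  | succ d ih =>
    rw [ih (by omega), show n + (d + 1) = n + d + 1 by omega, Finset.sum_range_succ']
    have h1 : ∀ k ∈ Finset.range (n + d), fwd n d k * V (n + d) k =
        ((k : ℝ) + 1) * fwd n d k * V (n + d + 1) k +
        ((n : ℝ) + d - k) * fwd n d k * V (n + d + 1) (k + 1) := by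
      intro k hk
      rw [Finset.mem_range] at hk
      rw [hV.2 (n + d) k (by omega) (by omega) (by omega)]
      push_cast
      ring
    rw [Finset.sum_congr rfl h1, Finset.sum_add_distrib]
    have h2 := Finset.sum_range_succ
      (fun k : ℕ => ((k : ℝ) + 1) * fwd n d k * V (n + d + 1) k) (n + d)
    rw [Finset.sum_range_succ', fwd_zero n hn d (n + d) le_rfl] at h2
    simp only [fwd, add_mul _ _ (V _ _), Finset.sum_add_distrib]
    push_cast at h2
    simp only [add_assoc] at *
    norm_num at h2 ⊢
    linear_combination -h2

lemma value (N κ : ℕ) (hκ : κ ≤ N - 1) (V : ℕ → ℕ → ℝ) (hV : IsTrunc N κ V) (n : ℕ)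
    (hn : 1 ≤ n) (d : ℕ) (hd : n + d = N) :
    V n 0 = fwd n d κ / eulerian N κ := by
  rw [duality N κ V hV n hn d hd.le, hd, Finset.sum_eq_single κ]
  · rw [hV.1 κ hκ, if_pos rfl]; ring
  · intro b hb hbκ
    rw [Finset.mem_range] at hb
    rw [hV.1 b (by omega), if_neg hbκ, mul_zero]
  · intro h
    rw [Finset.mem_range] at h
    omega

theorem stmt5 (N κ κ' : ℕ) (hN : 1 ≤ N) (hκ : κ ≤ κ') (hκ' : κ' ≤ N - 1)
    (V V' : ℕ → ℕ → ℝ) (hV : IsTrunc N κ V) (hV' : IsTrunc N κ' V')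
    (n : ℕ) (hn : 1 ≤ n) (hnN : n ≤ N) :
    V' n 0 ≤ V n 0 := by
  obtain ⟨m, rfl⟩ : ∃ m, n = m + 1 := ⟨n - 1, by omega⟩
  obtain ⟨d, rfl⟩ : ∃ d, N = m + 1 + d := ⟨N - (m + 1), by omega⟩
  rw [value _ κ (by omega) V hV (m + 1) hn d rfl, value _ κ' hκ' V' hV' (m + 1) hn d rfl]
  have h := lr m d κ κ' hκ
  have e : m + 1 + d = m + d + 1 := by omega
  rw [e] at h ⊢
  rw [div_le_div_iff₀ (eulerian_pos _ _ (by omega)) (eulerian_pos _ _ (by omega))]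
  exact h
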